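/- arXiv:1806.06199 — 3 statements merged into one kernel-verified Lean document; each statement's English description precedes it below -/
import Mathlib

section
/- Let k ≥ 3, n ≥ 1, 0 ≤ s ≤ n−1, and let c₀ ∈ B_s. In any legal firing sequence starting from c₀ with the bank vertex 0 fired exactly once at the first step, every stable configuration c' occurring strictly after a step at which the vertex s(k−1) is fired on the edge e_{s+1} (for s = 0 this means: occurring strictly after the first step) satisfies c₀ ≺ c'. -/
open Finset

/-- Vertex `v` belongs to the edge `e_t = {(t-1)(k-1), …, t(k-1)}` of the
hyperpath `P_n^k`. -/
def inEdge (k t v : ℕ) : Prop := (t - 1) * (k - 1) ≤ v ∧ v ≤ t * (k - 1)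

instance (k t v : ℕ) : Decidable (inEdge k t v) :=
  inferInstanceAs (Decidable (_ ∧ _))

/-- Firing the vertex `u` on the edge `e_t` of `P_n^k`: `u` loses `k-1` dollars
and every other vertex of `e_t` gains one dollar. -/
def fireStep (k t u : ℕ) (c : ℕ → ℤ) : ℕ → ℤ := fun v =>
  if v = u then c u - ((k : ℤ) - 1)
  else if inEdge k t v then c v + 1
  else c v

/-- A configuration on `P_n^k` (bank vertex `0`) is stable: at every vertex
`v ≠ 0` its value lies in `{0, …, k-2}`. -/
def StableConf (k n : ℕ) (c : ℕ → ℤ) : Prop :=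
  ∀ v, 1 ≤ v → v ≤ n * (k - 1) → 0 ≤ c v ∧ c v ≤ (k : ℤ) - 2

/-- A legal firing sequence on the hyperpath `P_n^k` with bank vertex `0`,
starting from a stable configuration `conf 0`, in which the bank is fired
exactly once, at the first step (on the edge `e₁`).  At every later step the
fired vertex is the largest vertex `v ≠ 0` whose value is `≥ k-1`, fired on
some edge containing it. -/
structure FiringSeq (k n : ℕ) where
  /-- the number of firing steps -/
  len : ℕ
  /-- the configurations `conf 0, conf 1, …, conf len` -/
  conf : ℕ → ℕ → ℤ
  /-- the vertex fired at step `j` (for `j < len`) -/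
  vert : ℕ → ℕ
  /-- the index of the edge on which step `j` fires (for `j < len`) -/
  edg : ℕ → ℕ
  one_le_len : 1 ≤ len
  start_stable : StableConf k n (conf 0)
  edg_mem : ∀ j < len, 1 ≤ edg j ∧ edg j ≤ n
  vert_mem : ∀ j < len, inEdge k (edg j) (vert j)
  conf_step : ∀ j < len, conf (j + 1) = fireStep k (edg j) (vert j) (conf j)
  first_vert : vert 0 = 0
  first_edg : edg 0 = 1
  bank_once : ∀ j, 1 ≤ j → j < len → vert j ≠ 0
  fire_legal : ∀ j, 1 ≤ j → j < len →
    (k : ℤ) - 1 ≤ conf j (vert j) ∧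
    ∀ v, vert j < v → v ≤ n * (k - 1) → conf j v < (k : ℤ) - 1

/-- Firing the vertex `u` on the complete graph `K_k` with vertex set
`{0, …, k-1}`: `u` loses `k-1` dollars and every other vertex gains one. -/
def fireK (k u : ℕ) (d : ℕ → ℤ) : ℕ → ℤ := fun v =>
  if v = u then d u - ((k : ℤ) - 1)
  else if v ≤ k - 1 then d v + 1
  else d v

/-- A configuration on `K_k` (vertices `{0,…,k-1}`, bank vertex `0`) is stable:
every non-bank vertex has value in `{0, …, k-2}`. -/
def StableK (k : ℕ) (d : ℕ → ℤ) : Prop :=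
  ∀ v, 1 ≤ v → v ≤ k - 1 → 0 ≤ d v ∧ d v ≤ (k : ℤ) - 2

/-- A stable configuration `d` on the complete graph `K_k` (vertices
`{0,…,k-1}`, bank vertex `0`) is critical: there is a nonempty `0`-legal firing
sequence starting and ending at `d` (non-bank vertices are fired only when
their value is `≥ k-1`; the bank is fired only at a stable configuration). -/
def CriticalK (k : ℕ) (d : ℕ → ℤ) : Prop :=
  StableK k d ∧
  ∃ (N : ℕ) (cs : ℕ → ℕ → ℤ) (vs : ℕ → ℕ),
    1 ≤ N ∧ cs 0 = d ∧ cs N = d ∧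
    (∀ j < N, vs j ≤ k - 1) ∧
    (∀ j < N, cs (j + 1) = fireK k (vs j) (cs j)) ∧
    (∀ j < N, vs j ≠ 0 → (k : ℤ) - 1 ≤ cs j (vs j)) ∧
    (∀ j < N, vs j = 0 → StableK k (cs j))

/-- The configuration `c̃^i` induced on the complete graph with vertex set
`e_i` and bank vertex `(i-1)(k-1)` by a configuration `c` on `P_n^k`. -/
def inducedConf (k i : ℕ) (c : ℕ → ℤ) : ℕ → ℤ := fun j => c ((i - 1) * (k - 1) + j)

/-- Membership of a configuration `c` on `P_n^k` in the set `B_s`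
(for `0 ≤ s ≤ n`): `c` is stable, `c̃^i` is critical for `1 ≤ i ≤ s`, and,
if `s < n`, `c̃^{s+1}` is not critical. -/
def MemB (k n s : ℕ) (c : ℕ → ℤ) : Prop :=
  StableConf k n c ∧
  (∀ i, 1 ≤ i → i ≤ s → CriticalK k (inducedConf k i c)) ∧
  (s < n → ¬ CriticalK k (inducedConf k (s + 1) c))

/-- The weight of a configuration: the sum of its values at the non-bank
vertices `1, …, n(k-1)`. -/
def wtConf (k n : ℕ) (c : ℕ → ℤ) : ℤ := ∑ v ∈ Finset.Icc 1 (n * (k - 1)), c v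

/-- The left anti-lexicographical order on configurations of `P_n^k`:
`c ≺ c'` iff `ω(c) < ω(c')`, or `ω(c) = ω(c')` and there is `t ≥ 1` with
`c i = c' i` for `1 ≤ i < t` and `c t > c' t`. -/
def PrecConf (k n : ℕ) (c c' : ℕ → ℤ) : Prop :=
  wtConf k n c < wtConf k n c' ∨
  (wtConf k n c = wtConf k n c' ∧
    ∃ t, 1 ≤ t ∧ (∀ i, 1 ≤ i → i < t → c i = c' i) ∧ c' t < c t)

namespace FiringSeq

variable {m n : ℕ}

/-- The number of times the vertex `v` is fired on the edge `e_t` before step `j`. -/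
def fires (S : FiringSeq (m + 1) n) (t v j : ℕ) : ℤ :=
  ∑ i ∈ range j, if S.edg i = t ∧ S.vert i = v then 1 else 0

/-- The number of firings on the edge `e_t` before step `j`. -/
def edgeFires (S : FiringSeq (m + 1) n) (t j : ℕ) : ℤ :=
  ∑ i ∈ range j, if S.edg i = t then 1 else 0

/-- The net amount received by the vertex `v` of `e_t` from the firings on `e_t` before step `j`. -/
def gain (S : FiringSeq (m + 1) n) (t v j : ℕ) : ℤ :=
  S.edgeFires t j - (m + 1) * S.fires t v j

theorem fires_succ (S : FiringSeq (m + 1) n) (t v j : ℕ) :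
    S.fires t v (j + 1) = S.fires t v j + if S.edg j = t ∧ S.vert j = v then 1 else 0 :=
  sum_range_succ _ _

theorem edgeFires_succ (S : FiringSeq (m + 1) n) (t j : ℕ) :
    S.edgeFires t (j + 1) = S.edgeFires t j + if S.edg j = t then 1 else 0 :=
  sum_range_succ _ _

theorem fires_mono (S : FiringSeq (m + 1) n) (t v : ℕ) : Monotone (S.fires t v) := by
  refine monotone_nat_of_le_succ fun j => ?_
  rw [fires_succ]
  split_ifs <;> simp

theorem fires_nonneg (S : FiringSeq (m + 1) n) (t v j : ℕ) : 0 ≤ S.fires t v j :=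
  sum_nonneg fun _ _ => by split_ifs <;> simp

/-- The firing that brings the number of firings of `v` on `e_t` to its final value. -/
theorem exists_last_fire (S : FiringSeq (m + 1) n) {t v j : ℕ} (h : 1 ≤ S.fires t v j) :
    ∃ i < j, S.edg i = t ∧ S.vert i = v ∧ S.fires t v i + 1 = S.fires t v j := by
  induction j with
  | zero => simp [fires] at h
  | succ j ih =>
    rw [fires_succ] at h ⊢
    by_cases hj : S.edg j = t ∧ S.vert j = v
    · exact ⟨j, by omega, hj.1, hj.2, by simp [hj]⟩
    · rw [if_neg hj, add_zero] at h ⊢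
      obtain ⟨i, hi, h'⟩ := ih h
      exact ⟨i, by omega, h'⟩

theorem vert_bounds (S : FiringSeq (m + 1) n) {t j : ℕ} (hj : j < S.len) (ht : S.edg j = t + 1) :
    S.vert j ∈ Icc (t * m) ((t + 1) * m) := by
  have := S.vert_mem j hj
  simpa [inEdge, ht] using this

theorem edgeFires_eq_sum (S : FiringSeq (m + 1) n) (t : ℕ) {j : ℕ} (hj : j ≤ S.len) :
    S.edgeFires (t + 1) j = ∑ v ∈ Icc (t * m) ((t + 1) * m), S.fires (t + 1) v j := by
  simp only [edgeFires, fires]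
  rw [sum_comm]
  refine sum_congr rfl fun i hi => ?_
  by_cases h : S.edg i = t + 1
  · have := S.vert_bounds (by simp at hi; omega) h
    simp only [h, true_and, if_true, sum_ite_eq, if_pos this]
  · simp [h]

theorem inEdge_iff {t u v : ℕ} (h1 : t * m < v) (h2 : v ≤ (t + 1) * m) (hu : 1 ≤ u) :
    inEdge (m + 1) u v ↔ u = t + 1 ∨ u = t + 2 ∧ v = (t + 1) * m := by
  obtain ⟨u, rfl⟩ := Nat.exists_eq_add_of_le' hu
  simp only [inEdge, Nat.add_sub_cancel]
  constructor
  · rintro ⟨h3, h4⟩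
    have h5 : t < u + 1 := Nat.lt_of_mul_lt_mul_right (a := m) (by omega)
    have h6 : u ≤ t + 1 := by
      by_contra! h
      have : (t + 2) * m ≤ u * m := Nat.mul_le_mul_right _ h
      have : 0 < m := by
        rcases Nat.eq_zero_or_pos m with rfl | h
        · simp at h1 h2; omega
        · exact h
      nlinarith
    rcases Nat.lt_or_ge t u with h | h
    · obtain rfl : u = t + 1 := by omega
      exact Or.inr ⟨rfl, by omega⟩
    · exact Or.inl (by omega)
  · rintro (h | ⟨h, rfl⟩)
    · obtain rfl : u = t := by omega
      omega
    · obtain rfl : u = t + 1 := by omega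
      exact ⟨le_rfl, Nat.mul_le_mul_right _ (by omega)⟩

theorem conf_eq (S : FiringSeq (m + 1) n) {t v : ℕ} (h1 : t * m < v) (h2 : v ≤ (t + 1) * m)
    {j : ℕ} (hj : j ≤ S.len) :
    S.conf j v = S.conf 0 v + S.gain (t + 1) v j +
      if v = (t + 1) * m then S.gain (t + 2) v j else 0 := by
  induction j with
  | zero => simp [gain, edgeFires, fires]
  | succ j ih =>
    have hu := (S.edg_mem j (by omega)).1
    have hmem := S.vert_mem j (by omega)
    have key := inEdge_iff h1 h2 hu
    rw [S.conf_step j (by omega)]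
    specialize ih (by omega)
    simp only [gain, edgeFires_succ, fires_succ, fireStep] at ih ⊢
    by_cases hv : v = S.vert j
    · subst hv
      rcases key.1 hmem with h | ⟨h, h'⟩
      · have hne : ¬ t + 1 = t + 2 := by omega
        simp only [h, hne, ih, true_and, false_and, if_true, if_false, add_zero]
        push_cast
        ring
      · have hne : ¬ t + 2 = t + 1 := by omega
        rw [if_pos h'] at ih ⊢
        simp only [h, hne, ih, true_and, false_and, if_true, if_false, add_zero]
        push_cast
        ring
    · rw [if_neg hv, ih]
      simp only [key, Ne.symm hv, and_false, if_false]
      by_cases h : S.edg j = t + 1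
      · simp [h]; ring
      · by_cases h' : S.edg j = t + 2
        · simp [h']
          split_ifs <;> ring
        · simp [h, h']

theorem conf_zero_eq (S : FiringSeq (m + 1) n) {j : ℕ} (hj : j ≤ S.len) (hm : 0 < m) :
    S.conf j 0 = S.conf 0 0 + S.gain 1 0 j := by
  induction j with
  | zero => simp [gain, edgeFires, fires]
  | succ j ih =>
    have hu := (S.edg_mem j (by omega)).1
    have hmem := S.vert_mem j (by omega)
    have key : inEdge (m + 1) (S.edg j) 0 ↔ S.edg j = 1 := by
      simp [inEdge]
      omega
    rw [S.conf_step j (by omega)]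
    specialize ih (by omega)
    simp only [gain, edgeFires_succ, fires_succ, fireStep, key] at ih ⊢
    by_cases hv : 0 = S.vert j
    · rw [← hv] at hmem
      simp [← hv, key.1 hmem, ih]
      ring
    · simp only [if_neg hv, ih, Ne.symm hv, and_false, if_false]
      split_ifs <;> ring

theorem sum_conf (S : FiringSeq (m + 1) n) {j : ℕ} (hj : j ≤ S.len) :
    ∑ v ∈ range (n * m + 1), S.conf j v = ∑ v ∈ range (n * m + 1), S.conf 0 v := by
  induction j with
  | zero => rfl
  | succ j ih =>
    rw [← ih (by omega), S.conf_step j (by omega)]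
    obtain ⟨hu, hun⟩ := S.edg_mem j (by omega)
    obtain ⟨u, hu⟩ := Nat.exists_eq_add_of_le' hu
    have hb := S.vert_bounds (by omega) hu
    have hle : (u + 1) * m ≤ n * m := Nat.mul_le_mul_right _ (by omega)
    have hfire : ∀ v, fireStep (m + 1) (S.edg j) (S.vert j) (S.conf j) v = S.conf j v +
        ((if v ∈ Icc (u * m) ((u + 1) * m) then 1 else 0) -
          if v = S.vert j then ((m : ℤ) + 1) else 0) := by
      intro v
      simp only [fireStep, hu, inEdge, Nat.add_sub_cancel, ← mem_Icc]
      by_cases h : v = S.vert j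
      · subst h
        simp only [hb, if_true]
        push_cast
        ring
      · simp only [h, if_false]
        split_ifs <;> ring
    have hsub : (range (n * m + 1)).filter (· ∈ Icc (u * m) ((u + 1) * m)) =
        Icc (u * m) ((u + 1) * m) := by
      ext v
      simp
      omega
    have hcard : (u + 1) * m + 1 - u * m = m + 1 := by
      rw [add_mul, one_mul]
      omega
    have hvert : S.vert j ∈ range (n * m + 1) := by
      simp at hb ⊢
      omega
    simp only [hfire]
    rw [sum_add_distrib, sum_sub_distrib, ← sum_filter, hsub, sum_ite_eq', if_pos hvert,
      sum_const, Nat.card_Icc, hcard]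
    simp

theorem wtConf_eq (S : FiringSeq (m + 1) n) {j : ℕ} (hj : j ≤ S.len) (hm : 0 < m) :
    wtConf (m + 1) n (S.conf j) = wtConf (m + 1) n (S.conf 0) - S.gain 1 0 j := by
  have h : ∀ c : ℕ → ℤ, ∑ v ∈ range (n * m + 1), c v = wtConf (m + 1) n c + c 0 := by
    intro c
    rw [sum_range_succ', wtConf, Nat.add_sub_cancel, range_eq_Ico, sum_Ico_add' c 0 (n * m) 1]
    rfl
  have := S.sum_conf hj
  rw [h, h, S.conf_zero_eq hj hm] at this
  linarith

theorem card_edge (t : ℕ) : #(Icc (t * m) ((t + 1) * m)) = m + 1 := by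
  rw [Nat.card_Icc, add_mul, one_mul]
  omega

theorem gain_nonpos_of_fires_le (S : FiringSeq (m + 1) n) {t j : ℕ} (hj : j ≤ S.len)
    (h : ∀ v ∈ Icc (t * m) ((t + 1) * m), S.fires (t + 1) v j ≤ S.fires (t + 1) (t * m) j) :
    S.gain (t + 1) (t * m) j ≤ 0 := by
  have := sum_le_card_nsmul _ _ _ h
  rw [← S.edgeFires_eq_sum t hj, card_edge] at this
  simp at this
  simp only [gain]
  linarith

/-- On each edge, no vertex is fired more often than the bank vertex of that edge. -/
theorem fires_le (S : FiringSeq (m + 1) n) {j : ℕ} (hj : j ≤ S.len) :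
    ∀ t, ∀ v ∈ Icc (t * m) ((t + 1) * m),
      S.fires (t + 1) v j ≤ S.fires (t + 1) (t * m) j := by
  induction j with
  | zero => simp [fires]
  | succ j ih =>
    intro t v hv
    specialize ih (by omega)
    rcases eq_or_ne v (t * m) with rfl | hne
    · exact le_rfl
    have hmono := S.fires_mono (t + 1) (t * m) (Nat.le_succ j)
    by_cases hf : S.edg j = t + 1 ∧ S.vert j = v
    · have hold := ih t v hv
      rcases lt_or_eq_of_le hold with h | h
      · have := S.fires_succ (t + 1) v j
        rw [if_pos hf] at this
        simp only [Nat.succ_eq_add_one] at hmono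
        omega
      · exfalso
        rw [mem_Icc] at hv
        have hlt : t * m < v := by omega
        have hj1 : 1 ≤ j := by
          by_contra h0
          obtain rfl : j = 0 := by omega
          have := S.first_vert
          omega
        have hlegal := (S.fire_legal j hj1 (by omega)).1
        have hconf := S.conf_eq hlt hv.2 (j := j) (by omega)
        have hgain := S.gain_nonpos_of_fires_le (by omega) (ih t)
        have hgain' := S.gain_nonpos_of_fires_le (t := t + 1) (by omega) (ih (t + 1))
        have hedge := (S.edg_mem j (by omega)).2
        have hle : (t + 1) * m ≤ n * m := Nat.mul_le_mul_right _ (by omega)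
        have hst := (S.start_stable v (by omega) (by simp; omega)).2
        rw [hf.2] at hlegal
        have : S.gain (t + 1) v j = S.gain (t + 1) (t * m) j := by simp [gain, h]
        push_cast at hlegal hst
        split_ifs at hconf with hif
        · rw [← hif] at hgain'
          linarith
        · linarith
    · rw [S.fires_succ (t + 1) v, if_neg hf, add_zero]
      exact (ih t v hv).trans hmono

theorem gain_nonpos (S : FiringSeq (m + 1) n) {j : ℕ} (hj : j ≤ S.len) (t : ℕ) :
    S.gain (t + 1) (t * m) j ≤ 0 :=
  S.gain_nonpos_of_fires_le hj (S.fires_le hj t)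

theorem conf_le (S : FiringSeq (m + 1) n) {t v : ℕ} (h1 : t * m < v) (h2 : v ≤ (t + 1) * m)
    {j : ℕ} (hj : j ≤ S.len) : S.conf j v ≤ S.conf 0 v + S.gain (t + 1) v j := by
  rw [S.conf_eq h1 h2 hj]
  split_ifs with h
  · have := S.gain_nonpos hj (t + 1)
    rw [← h] at this
    linarith
  · linarith

theorem fires_eq_of_gain_eq_zero (S : FiringSeq (m + 1) n) {t j : ℕ} (hj : j ≤ S.len)
    (h : S.gain (t + 1) (t * m) j = 0) :
    ∀ v ∈ Icc (t * m) ((t + 1) * m), S.fires (t + 1) v j = S.fires (t + 1) (t * m) j := by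
  rw [← sum_eq_sum_iff_of_le (S.fires_le hj t), ← S.edgeFires_eq_sum t hj, sum_const, card_edge]
  simp only [gain] at h
  simp
  linarith

end FiringSeq

/-- Firing the vertices `vs 0, vs 1, …` of `K_k` in turn. -/
def fireKSeq (k : ℕ) (vs : ℕ → ℕ) (d : ℕ → ℤ) : ℕ → ℕ → ℤ
  | 0 => d
  | j + 1 => fireK k (vs j) (fireKSeq k vs d j)

theorem fireKSeq_apply (m : ℕ) (vs : ℕ → ℕ) (d : ℕ → ℤ) (j : ℕ) {v : ℕ} (hv : v ≤ m) :
    fireKSeq (m + 1) vs d j v =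
      d v + j - (m + 1) * ∑ i ∈ range j, if vs i = v then (1 : ℤ) else 0 := by
  induction j with
  | zero => simp [fireKSeq]
  | succ j ih =>
    rw [sum_range_succ]
    simp only [fireKSeq, fireK, Nat.add_sub_cancel, hv, if_true]
    by_cases h : v = vs j
    · subst h
      simp only [if_true, ih]
      push_cast
      ring
    · simp only [h, Ne.symm h, if_false, ih]
      push_cast
      ring

theorem fireKSeq_apply_of_lt (m : ℕ) (vs : ℕ → ℕ) (d : ℕ → ℤ) {j : ℕ} {v : ℕ} (hv : m < v)
    (hvs : ∀ i < j, vs i ≤ m) : fireKSeq (m + 1) vs d j v = d v := by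
  induction j with
  | zero => rfl
  | succ j ih =>
    have := hvs j (by omega)
    simp only [fireKSeq, fireK]
    rw [if_neg (by omega), if_neg (by omega), ih fun i hi => hvs i (by omega)]

/-- A stable configuration on `K_k` is critical if its non-bank vertices can be fired one after
the other following a firing of the bank. -/
theorem criticalK_of_perm {m : ℕ} {d : ℕ → ℤ} (hd : StableK (m + 1) d)
    (σ : Equiv.Perm (Fin m)) (h : ∀ i, (m : ℤ) ≤ d (σ i + 1) + 1 + (i : ℕ)) :
    CriticalK (m + 1) d := by
  let vs : ℕ → ℕ := fun j => if hj : j - 1 < m then (if j = 0 then 0 else σ ⟨j - 1, hj⟩ + 1) else 0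
  have hvs0 : vs 0 = 0 := by simp [vs]
  have hvs : ∀ i : Fin m, vs (i + 1) = σ i + 1 := fun i => by simp [vs]
  have hle : ∀ j, vs j ≤ m := by
    intro j
    simp only [vs]
    split_ifs <;> omega
  have hcount : ∀ v ≤ m, ∑ i ∈ range (m + 1), (if vs i = v then (1 : ℤ) else 0) = 1 := by
    intro v hv
    rw [sum_range_succ', hvs0, Finset.sum_range]
    simp only [hvs]
    rcases v with _ | v
    · simp
    · have : ∀ i : Fin m, ((σ i : ℕ) + 1 = v + 1) ↔ i = σ.symm ⟨v, hv⟩ := by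
        intro i
        rw [Equiv.eq_symm_apply, Fin.ext_iff]
        simp
      simp only [this, sum_ite_eq', mem_univ, if_true]
      simp
  refine ⟨hd, m + 1, fireKSeq (m + 1) vs d, vs, by omega, rfl, ?_, fun j _ => hle j,
    fun j _ => rfl, ?_, ?_⟩
  · funext v
    rcases Nat.lt_or_ge m v with hv | hv
    · exact fireKSeq_apply_of_lt m vs d hv fun i _ => hle i
    · rw [fireKSeq_apply m vs d _ hv, hcount v hv]
      push_cast
      ring
  · intro j hj hne
    rcases j with _ | j
    · exact absurd hvs0 hne
    rw [fireKSeq_apply m vs d _ (hle _), hvs ⟨j, by omega⟩, sum_eq_zero]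
    · have := h ⟨j, by omega⟩
      push_cast
      simp at this ⊢
      linarith
    · intro i hi
      rw [mem_range] at hi
      rcases i with _ | i
      · simp [hvs0]
      · rw [hvs ⟨i, by omega⟩, if_neg]
        intro heq
        have := σ.injective (Fin.ext (Nat.succ_injective heq))
        simp at this
        omega
  · intro j hj h0
    rcases j with _ | j
    · exact hd
    · have := hvs ⟨j, by omega⟩
      simp only at this
      omega

/-- A stable configuration on `K_k` is critical if its non-bank vertices carry times `τ` such that
every vertex can be fired after the bank and the vertices with a smaller time. -/
theorem criticalK_of_times {m : ℕ} {d : ℕ → ℤ} (hd : StableK (m + 1) d) (τ : Fin m → ℕ)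
    (h : ∀ v : Fin m, (m : ℤ) ≤ d (v + 1) + 1 + #{w | τ w < τ v}) : CriticalK (m + 1) d := by
  refine criticalK_of_perm hd (Tuple.sort τ) fun i => (h (Tuple.sort τ i)).trans ?_
  have hmono : Monotone (τ ∘ Tuple.sort τ) := Tuple.monotone_sort τ
  have hcard : #{w | τ w < τ (Tuple.sort τ i)} ≤ #((Iio i).map (Tuple.sort τ).toEmbedding) := by
    refine card_le_card fun w hw => ?_
    simp only [mem_filter, mem_univ, true_and] at hw
    refine mem_map.2 ⟨(Tuple.sort τ).symm w, mem_Iio.2 ?_, by simp⟩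
    by_contra! hge
    have := hmono hge
    simp at this
    omega
  rw [card_map, Fin.card_Iio] at hcard
  have : ((#{w | τ w < τ (Tuple.sort τ i)} : ℕ) : ℤ) ≤ (i : ℕ) := by exact_mod_cast hcard
  linarith

namespace FiringSeq

variable {m n : ℕ}

/-- If the bank vertex of an edge is fired on that edge and gets everything back, then the
starting configuration induced on that edge is critical. -/
theorem criticalK_of_gain_eq_zero (S : FiringSeq (m + 1) n) {s j : ℕ} (hs : s < n)
    (hj : j ≤ S.len) (hfire : 1 ≤ S.fires (s + 1) (s * m) j)
    (hgain : S.gain (s + 1) (s * m) j = 0) :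
    CriticalK (m + 1) (inducedConf (m + 1) (s + 1) (S.conf 0)) := by
  have heq := S.fires_eq_of_gain_eq_zero hj hgain
  have hsm : (s + 1) * m = s * m + m := by ring
  have hle : (s + 1) * m ≤ n * m := Nat.mul_le_mul_right _ (by omega)
  have hmem : ∀ v : Fin m, s * m + (v + 1) ∈ Icc (s * m) ((s + 1) * m) := by
    intro v
    rw [mem_Icc]
    omega
  have hlast : ∀ v : Fin m, ∃ i < j, S.edg i = s + 1 ∧ S.vert i = s * m + (v + 1) ∧
      S.fires (s + 1) (s * m + (v + 1)) i + 1 = S.fires (s + 1) (s * m) j := by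
    intro v
    rw [← heq _ (hmem v)] at hfire ⊢
    exact S.exists_last_fire hfire
  choose τ hτj _ hτv hτf using hlast
  refine criticalK_of_times ?_ τ fun v => ?_
  · intro v hv1 hv2
    simp only [inducedConf, Nat.add_sub_cancel] at hv2 ⊢
    exact S.start_stable _ (by omega) (by simp; omega)
  · have hpos : 1 ≤ τ v := by
      by_contra h0
      have := hτv v
      rw [show τ v = 0 by omega, S.first_vert] at this
      omega
    have hv := hτj v
    have hlegal := (S.fire_legal (τ v) hpos (by omega)).1
    have hmemv := mem_Icc.1 (hmem v)
    have hconf := S.conf_le (t := s) (by omega) hmemv.2 (j := τ v) (by omega)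
    have hedge : S.edgeFires (s + 1) (τ v) = S.fires (s + 1) (s * m) (τ v) +
        ∑ w : Fin m, S.fires (s + 1) (s * m + (w + 1)) (τ v) := by
      rw [S.edgeFires_eq_sum s (by omega), ← Finset.sum_range
        (fun w => S.fires (s + 1) (s * m + (w + 1)) (τ v)),
        show Icc (s * m) ((s + 1) * m) = Ico (s * m) (s * m + m + 1) by
          ext; simp; omega,
        sum_Ico_eq_sum_range, show s * m + m + 1 - s * m = m + 1 by omega, sum_range_succ', add_comm]
      rfl
    have hbank := S.fires_mono (s + 1) (s * m) hv.le
    have hother : ∀ w ∈ (univ : Finset (Fin m)), S.fires (s + 1) (s * m + (w + 1)) (τ v) ≤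
        (S.fires (s + 1) (s * m) j - 1) + if τ w < τ v then 1 else 0 := by
      intro w _
      split_ifs with hw
      · have := S.fires_mono (s + 1) (s * m + (w + 1)) hv.le
        rw [heq _ (hmem w)] at this
        linarith
      · have := S.fires_mono (s + 1) (s * m + (w + 1)) (not_lt.1 hw)
        have := hτf w
        linarith
    have hsum := sum_le_sum hother
    rw [sum_add_distrib, sum_const, card_univ, Fintype.card_fin, sum_boole, nsmul_eq_mul] at hsum
    have hfv : S.fires (s + 1) (s * m + (v + 1)) (τ v) = S.fires (s + 1) (s * m) j - 1 := by
      linarith [hτf v]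
    rw [hτv v] at hlegal
    simp only [gain, hfv] at hconf
    simp only [inducedConf, Nat.add_sub_cancel]
    push_cast at hlegal hsum ⊢
    linarith

/-- If the bank vertices of the first `t` edges get everything back, then every vertex before
`tm` ends up with its starting value. -/
theorem conf_eq_of_gain_eq_zero (S : FiringSeq (m + 1) n) {t j : ℕ} (hj : j ≤ S.len)
    (h : ∀ u < t, S.gain (u + 1) (u * m) j = 0) {v : ℕ} (hv : 1 ≤ v) (hvt : v < t * m) :
    S.conf j v = S.conf 0 v := by
  have hm : 0 < m := Nat.pos_of_ne_zero (by rintro rfl; simp at hvt)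
  have h1 : (v - 1) / m * m < v := by
    have := Nat.div_mul_le_self (v - 1) m
    omega
  have h2 : v ≤ ((v - 1) / m + 1) * m := by
    have := Nat.lt_div_mul_add (a := v - 1) hm
    rw [add_mul, one_mul]
    omega
  generalize (v - 1) / m = u at h1 h2
  have hut : u < t := Nat.lt_of_mul_lt_mul_right (a := m) (by omega)
  have hfire := S.fires_eq_of_gain_eq_zero hj (h u hut) v (mem_Icc.2 ⟨h1.le, h2⟩)
  have hgain : S.gain (u + 1) v j = 0 := by
    rw [← h u hut]
    simp [gain, hfire]
  rw [S.conf_eq h1 h2 hj, hgain]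
  split_ifs with hif
  · have hut' : u + 1 < t := Nat.lt_of_mul_lt_mul_right (a := m) (by omega)
    have := h (u + 1) hut'
    rw [← hif] at this
    simp [this]
  · simp

/-- If the bank vertex of some edge loses money to it, then the configuration has increased. -/
theorem precConf_of_gain_neg (S : FiringSeq (m + 1) n) (hm : 0 < m) {s j : ℕ} (hj : j ≤ S.len)
    (h : S.gain (s + 1) (s * m) j < 0) : PrecConf (m + 1) n (S.conf 0) (S.conf j) := by
  have hex : ∃ t, S.gain (t + 1) (t * m) j < 0 := ⟨s, h⟩
  obtain ⟨t, ht, hmin⟩ : ∃ t, S.gain (t + 1) (t * m) j < 0 ∧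
      ∀ u < t, S.gain (u + 1) (u * m) j = 0 :=
    ⟨Nat.find hex, Nat.find_spec hex, fun u hu =>
      le_antisymm (S.gain_nonpos hj u) (not_lt.1 (Nat.find_min hex hu))⟩
  have hwt := S.wtConf_eq hj hm
  rcases t with _ | t
  · left
    rw [zero_add, zero_mul] at ht
    linarith
  · right
    have h0 := hmin 0 (by omega)
    rw [zero_add, zero_mul] at h0
    have hlt : t * m < (t + 1) * m := Nat.mul_lt_mul_of_pos_right (by omega) hm
    refine ⟨by rw [hwt, h0, sub_zero], (t + 1) * m, by omega, fun i hi hit =>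
      (S.conf_eq_of_gain_eq_zero hj hmin hi hit).symm, ?_⟩
    have hfire := S.fires_eq_of_gain_eq_zero hj (hmin t (by omega)) _
      (mem_Icc.2 ⟨hlt.le, le_rfl⟩)
    have hgain : S.gain (t + 1) ((t + 1) * m) j = 0 := by
      rw [← hmin t (by omega)]
      simp [gain, hfire]
    rw [S.conf_eq hlt le_rfl hj, hgain, if_pos rfl]
    linarith

end FiringSeq

/-- For `0 ≤ s ≤ n-1` and `c₀ ∈ B_s`: in any legal firing sequence starting
from `c₀` (bank fired exactly once, at the first step), every stable
configuration occurring strictly after a step at which the vertex `s(k-1)` is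
fired on the edge `e_{s+1}` satisfies `c₀ ≺ c'`.  (For `s = 0` the vertex
`s(k-1) = 0` is the bank, fired at the first step on `e₁`.) -/
theorem hyperpath_stable_succ (k n s : ℕ) (hk : 3 ≤ k) (hn : 1 ≤ n)
    (hs : s ≤ n - 1) (c0 : ℕ → ℤ) (hc0 : MemB k n s c0)
    (S : FiringSeq k n) (hstart : S.conf 0 = c0)
    (j0 : ℕ) (hj0 : j0 < S.len)
    (hv : S.vert j0 = s * (k - 1)) (he : S.edg j0 = s + 1)
    (j : ℕ) (hj1 : j0 < j) (hj2 : j ≤ S.len)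
    (hstable : StableConf k n (S.conf j)) :
    PrecConf k n c0 (S.conf j) := by
  obtain ⟨m, rfl⟩ : ∃ m, k = m + 1 := ⟨k - 1, by omega⟩
  subst hstart
  rw [Nat.add_sub_cancel] at hv
  have hfire : 1 ≤ S.fires (s + 1) (s * m) j := by
    have h1 := S.fires_mono (s + 1) (s * m) hj1
    have h2 := S.fires_nonneg (s + 1) (s * m) j0
    have h3 := S.fires_succ (s + 1) (s * m) j0
    rw [if_pos ⟨he, hv⟩] at h3
    rw [Nat.succ_eq_add_one] at h1
    linarith
  refine S.precConf_of_gain_neg (by omega) (s := s) hj2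
    (lt_of_le_of_ne (S.gain_nonpos hj2 s) fun h => ?_)
  exact hc0.2.2 (by omega) (S.criticalK_of_gain_eq_zero (by omega) hj2 hfire h)
end

section
/- Let k ≥ 3, n ≥ 1, and let c₀ be a stable configuration on P_n^k whose induced configuration c̃^1 on the complete graph with vertex set e₁ and bank vertex 0 is critical. Then there is a legal firing sequence starting and ending at c₀ in which the bank vertex 0 is fired exactly once (the first step, on e₁) and each of the vertices 1, …, k−1 is fired exactly once, each time on the edge e₁; in particular, c₀ is a recurrent configuration of the dollar game on P_n^k. -/
open Finset

/-- In a firing sequence on `K_k`, a vertex that does not fire gains a dollar at every step. -/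
lemma fireK_not_fired {k N : ℕ} {cs : ℕ → ℕ → ℤ} {vs : ℕ → ℕ}
    (hstep : ∀ j < N, cs (j + 1) = fireK k (vs j) (cs j)) {v a : ℕ} (hv : v ≤ k - 1)
    (m : ℕ) (hm : a + m ≤ N) (hnot : ∀ j, a ≤ j → j < a + m → vs j ≠ v) :
    cs (a + m) v = cs a v + m := by
  induction m with
  | zero => simp
  | succ m ih =>
    have h := ih (by omega) fun j hj hj' => hnot j hj (by omega)
    rw [← add_assoc, hstep (a + m) (by omega), fireK,
      if_neg (hnot (a + m) (by omega) (by omega)).symm, if_pos hv, h]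
    push_cast
    ring

/-- A critical configuration on `K_k` satisfies the burning condition: every nonempty set `A` of
non-bank vertices contains a vertex with at least `#A - 1` dollars. -/
lemma CriticalK.exists_card_le {k : ℕ} {d : ℕ → ℤ} (hd : CriticalK k d) {A : Finset ℕ}
    (hA : A ⊆ Icc 1 (k - 1)) (hne : A.Nonempty) : ∃ v ∈ A, (#A : ℤ) ≤ d v + 1 := by
  obtain ⟨-, N, cs, vs, hN, h0, hend, -, hstep, hlegal, -⟩ := hd
  have hlast : ∀ v ∈ A, ∃ t < N, vs t = v ∧ ∀ j, t < j → j < N → vs j ≠ v := by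
    intro v hv
    have hvk := (mem_Icc.1 (hA hv)).2
    have hfire : ((range N).filter fun j => vs j = v).Nonempty := by
      by_contra hempty
      rw [not_nonempty_iff_eq_empty, filter_eq_empty_iff] at hempty
      have h := fireK_not_fired hstep hvk (a := 0) N (by omega)
        fun j _ hj => hempty (mem_range.2 (by omega))
      rw [zero_add, h0, hend] at h
      omega
    obtain ⟨t, ht, hmax⟩ := exists_max_image _ id hfire
    rw [mem_filter, mem_range] at ht
    refine ⟨t, ht.1, ht.2, fun j htj hjN hj => ?_⟩
    have := hmax j (mem_filter.2 ⟨mem_range.2 hjN, hj⟩)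
    simp only [id] at this
    omega
  choose! t htN hvt hafter using hlast
  obtain ⟨v, hv, hmin⟩ := exists_min_image A t hne
  refine ⟨v, hv, ?_⟩
  have hvA := mem_Icc.1 (hA hv)
  have hcard : #A ≤ #(Ico (t v) N) := by
    refine card_le_card_of_injOn t (fun w hw => ?_) fun w hw w' hw' hww' => ?_
    · exact mem_coe.2 (mem_Ico.2 ⟨hmin w hw, htN w hw⟩)
    · rw [← hvt w hw, ← hvt w' hw', hww']
  rw [Nat.card_Ico] at hcard
  have htv := htN v hv
  have hgain := fireK_not_fired hstep hvA.2 (a := t v + 1) (N - (t v + 1)) (by omega)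
    fun j hj hj' => hafter v hv j (by omega) (by omega)
  rw [show t v + 1 + (N - (t v + 1)) = N by omega, hend, hstep _ htv, fireK,
    if_pos (hvt v hv).symm] at hgain
  have hpos := hlegal (t v) htv (by rw [hvt v hv]; omega)
  omega

/-- The configuration obtained from `c` by firing the bank `0` and each vertex of `F` once on the
edge `e₁`. -/
def firedConf (k : ℕ) (c : ℕ → ℤ) (F : Finset ℕ) : ℕ → ℤ := fun v =>
  if v = 0 then c 0 - ((k : ℤ) - 1) + #F
  else if v ≤ k - 1 then c v + 1 + #F - (if v ∈ F then (k : ℤ) else 0)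
  else c v

lemma fireStep_bank {k : ℕ} (c : ℕ → ℤ) : fireStep k 1 0 c = firedConf k c ∅ := by
  funext v
  simp only [fireStep, firedConf, inEdge]
  split_ifs <;> simp_all

lemma fireStep_firedConf {k u : ℕ} (c : ℕ → ℤ) {F : Finset ℕ} (hu : u ∈ Icc 1 (k - 1))
    (huF : u ∉ F) : fireStep k 1 u (firedConf k c F) = firedConf k c (insert u F) := by
  rw [mem_Icc] at hu
  funext v
  simp only [fireStep, firedConf, inEdge, card_insert_of_notMem huF, mem_insert]
  by_cases hvu : v = u
  · subst hvu
    have hv0 : v ≠ 0 := by omega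
    simp only [hv0, hu.2, huF, if_true, if_false, true_or]
    push_cast
    ring
  · simp only [hvu, false_or, if_false]
    split_ifs <;> omega

lemma firedConf_Icc {k : ℕ} (hk : 1 ≤ k) (c : ℕ → ℤ) : firedConf k c (Icc 1 (k - 1)) = c := by
  funext v
  simp only [firedConf, Nat.card_Icc, mem_Icc]
  split_ifs with h
  · subst h; omega
  all_goals omega

/-- As long as not all vertices of `e₁` have been fired, the largest unstable vertex of the current
configuration is an unfired vertex of `e₁`. -/
lemma exists_next_firing {k n : ℕ} {c : ℕ → ℤ} (hst : StableConf k n c)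
    (hn : 1 ≤ n) (hcrit : CriticalK k (inducedConf k 1 c)) {F : Finset ℕ}
    (hF : F ⊂ Icc 1 (k - 1)) :
    ∃ u ∈ Icc 1 (k - 1) \ F, (k : ℤ) - 1 ≤ firedConf k c F u ∧
      ∀ v, u < v → v ≤ n * (k - 1) → firedConf k c F v < (k : ℤ) - 1 := by
  have hkn : k - 1 ≤ n * (k - 1) := Nat.le_mul_of_pos_left _ hn
  have hcard := card_lt_card hF
  have hsdiff := card_sdiff_of_subset hF.1
  rw [Nat.card_Icc] at hcard hsdiff
  obtain ⟨w, hw, hwA⟩ := hcrit.exists_card_le (sdiff_subset (t := F))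
    (card_pos.1 (by omega))
  have hunstable : ((Icc 1 (n * (k - 1))).filter
      fun v => (k : ℤ) - 1 ≤ firedConf k c F v).Nonempty := by
    refine ⟨w, ?_⟩
    simp only [mem_sdiff, mem_Icc] at hw
    simp only [inducedConf, Nat.sub_self, zero_mul, zero_add] at hwA
    rw [mem_filter, mem_Icc, firedConf, if_neg (by omega), if_pos hw.1.2, if_neg hw.2]
    omega
  obtain ⟨u, hu, hmax⟩ := exists_max_image _ id hunstable
  rw [mem_filter, mem_Icc] at hu
  refine ⟨u, ?_, hu.2, fun v huv hv => ?_⟩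
  · have hs := hst u hu.1.1 hu.1.2
    have hfire := hu.2
    rw [firedConf, if_neg (by omega)] at hfire
    rw [mem_sdiff, mem_Icc]
    split_ifs at hfire with h1 h2
    · omega
    · exact ⟨⟨hu.1.1, h1⟩, h2⟩
    · omega
  · by_contra hcon
    have := hmax v (mem_filter.2 ⟨mem_Icc.2 ⟨by omega, hv⟩, by omega⟩)
    simp only [id] at this
    omega

/-- The finite sets obtained from `∅` by repeatedly inserting the element selected by `next`. -/
def insertSeq (next : Finset ℕ → ℕ) : ℕ → Finset ℕ
  | 0 => ∅
  | j + 1 => insert (next (insertSeq next j)) (insertSeq next j)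

lemma insertSeq_eq_image (next : Finset ℕ → ℕ) (m : ℕ) :
    insertSeq next m = (range m).image fun j => next (insertSeq next j) := by
  induction m with
  | zero => rfl
  | succ m ih => rw [range_add_one, image_insert, ← ih, insertSeq]

lemma insertSeq_subset_and_card {next : Finset ℕ → ℕ} {s : Finset ℕ}
    (hnext : ∀ F, F ⊂ s → next F ∈ s \ F) (m : ℕ) (hm : m ≤ #s) :
    insertSeq next m ⊆ s ∧ #(insertSeq next m) = m := by
  induction m with
  | zero => simp [insertSeq]
  | succ m ih =>
    obtain ⟨hsub, hcard⟩ := ih (by omega)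
    have h := mem_sdiff.1 (hnext _ (hsub.ssubset_of_ne fun h => by rw [h] at hcard; omega))
    exact ⟨insert_subset h.1 hsub, by rw [insertSeq, card_insert_of_notMem h.2, hcard]⟩

/-- Let `c₀` be a stable configuration on `P_n^k` whose induced configuration
`c̃¹` on the complete graph with vertex set `e₁` and bank vertex `0` is
critical.  Then there is a legal firing sequence starting and ending at `c₀`
in which the bank vertex `0` is fired exactly once (the first step, on `e₁`),
every later step fires a vertex of `{1,…,k-1}` on the edge `e₁`, and each
vertex of `{1,…,k-1}` is fired exactly once; in particular `c₀` is a recurrent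
configuration of the dollar game on `P_n^k`. -/
theorem hyperpath_critical_recurrent (k n : ℕ) (hk : 3 ≤ k) (hn : 1 ≤ n)
    (c0 : ℕ → ℤ) (hst : StableConf k n c0)
    (hcrit : CriticalK k (inducedConf k 1 c0)) :
    ∃ S : FiringSeq k n, S.conf 0 = c0 ∧ S.conf S.len = c0 ∧
      (∀ j, 1 ≤ j → j < S.len →
        S.edg j = 1 ∧ 1 ≤ S.vert j ∧ S.vert j ≤ k - 1) ∧
      (∀ v, 1 ≤ v → v ≤ k - 1 →
        ((Finset.range S.len).filter (fun j => S.vert j = v)).card = 1) := by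
  choose! next hmem hlegal using fun F => exists_next_firing (F := F) hst hn hcrit
  have hcardIcc : #(Icc 1 (k - 1)) = k - 1 := by simp
  have hseq := insertSeq_subset_and_card hmem
  rw [hcardIcc] at hseq
  have hss : ∀ j < k - 1, insertSeq next j ⊂ Icc 1 (k - 1) := fun j hj =>
    (hseq j hj.le).1.ssubset_of_ne fun h => by
      have := (hseq j hj.le).2
      rw [h] at this
      omega
  have hfull : insertSeq next (k - 1) = Icc 1 (k - 1) :=
    eq_of_subset_of_card_le (hseq _ le_rfl).1 (by rw [(hseq _ le_rfl).2, hcardIcc])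
  have hvert : ∀ j < k - 1, next (insertSeq next j) ∈ Icc 1 (k - 1) ∧
      next (insertSeq next j) ∉ insertSeq next j := fun j hj => mem_sdiff.1 (hmem _ (hss j hj))
  have hinj : Set.InjOn (fun j => next (insertSeq next j)) (range (k - 1)) := by
    rw [← card_image_iff, ← insertSeq_eq_image, hfull, hcardIcc, card_range]
  let conf : ℕ → ℕ → ℤ
    | 0 => c0
    | j + 1 => firedConf k c0 (insertSeq next j)
  let vert : ℕ → ℕ
    | 0 => 0
    | j + 1 => next (insertSeq next j)
  have hlast : conf k = c0 := by
    obtain ⟨m, rfl⟩ : ∃ m, k = m + 1 := ⟨k - 1, by omega⟩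
    change firedConf (m + 1) c0 (insertSeq next m) = c0
    rw [show insertSeq next m = Icc 1 (m + 1 - 1) from hfull, firedConf_Icc (by omega)]
  have hrange : ∀ j, 1 ≤ j → j < k → 1 ≤ vert j ∧ vert j ≤ k - 1 := by
    rintro (_ | j) h1 hj
    · omega
    · exact mem_Icc.1 (hvert j (by omega)).1
  refine ⟨{ len := k, conf := conf, vert := vert, edg := fun _ => 1
            one_le_len := by omega
            start_stable := hst
            edg_mem := fun _ _ => ⟨le_rfl, hn⟩
            vert_mem := ?_
            conf_step := ?_
            first_vert := rfl
            first_edg := rfl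
            bank_once := fun j h1 hj => by have := hrange j h1 hj; omega
            fire_legal := ?_ }, rfl, hlast, fun j h1 hj => ⟨rfl, hrange j h1 hj⟩, ?_⟩
  · rintro (_ | j) hj
    · simp [inEdge, vert]
    · simpa [inEdge] using (hrange (j + 1) (by omega) hj).2
  · rintro (_ | j) hj
    · exact (fireStep_bank c0).symm
    · have h := hvert j (by omega)
      exact (fireStep_firedConf c0 h.1 h.2).symm
  · rintro (_ | j) h1 hj
    · omega
    · exact hlegal _ (hss j (by omega))
  · intro v h1 hv
    have hvF : v ∈ insertSeq next (k - 1) := by rw [hfull, mem_Icc]; exact ⟨h1, hv⟩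
    rw [insertSeq_eq_image, mem_image] at hvF
    obtain ⟨i, hi, rfl⟩ := hvF
    change #((range k).filter fun j => vert j = _) = 1
    rw [card_eq_one]
    refine ⟨i + 1, ?_⟩
    ext j
    rw [mem_filter, mem_range, mem_singleton]
    rw [mem_range] at hi
    constructor
    · rintro ⟨hj, hvj⟩
      obtain _ | j := j
      · change 0 = _ at hvj
        omega
      · rw [hinj (mem_coe.2 (mem_range.2 (by omega))) (mem_coe.2 (mem_range.2 hi)) hvj]
    · rintro rfl
      exact ⟨by omega, rfl⟩
end

section
/- Let k ≥ 3 and n ≥ 1, and identify stable configurations on P_n^k with their tuples of values at the vertices 1, …, n(k−1) (each value in {0,…,k−2}). Then for every 0 ≤ s ≤ n−1 the cardinality of B_s equals k^{s(k−2)}·((k−1)^{k−1} − k^{k−2})·(k−1)^{(n−s−1)(k−1)}, and the cardinality of B_n equals k^{n(k−2)}. -/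
open Finset

/-- The stable configuration on `P_n^k` determined by a tuple of values
(in `{0,…,k-2}`) at the vertices `1, …, n(k-1)`; the bank vertex `0` (and any
index beyond the vertex set) gets the value `0`. -/
def tupleConf (k n : ℕ) (f : Fin (n * (k - 1)) → Fin (k - 1)) : ℕ → ℤ :=
  fun v => if h : 1 ≤ v ∧ v ≤ n * (k - 1) then ((f ⟨v - 1, by omega⟩).val : ℤ) else 0

/-- The tuple `f` belongs to `B_s`: the induced configurations `c̃^i` are
critical for `1 ≤ i ≤ s` and, if `s < n`, `c̃^{s+1}` is not critical. -/
def MemBtuple (k n s : ℕ) (f : Fin (n * (k - 1)) → Fin (k - 1)) : Prop :=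
  (∀ i, 1 ≤ i → i ≤ s → CriticalK k (inducedConf k i (tupleConf k n f))) ∧
  (s < n → ¬ CriticalK k (inducedConf k (s + 1) (tupleConf k n f)))

/-- Firing along `vs` changes each value by the elapsed time minus `m + 1` for every own firing. -/
theorem firing_sequence_apply {m N : ℕ} {cs : ℕ → ℕ → ℤ} {vs : ℕ → ℕ}
    (hcs : ∀ j < N, cs (j + 1) = fireK (m + 1) (vs j) (cs j)) {v : ℕ} (hv : v ≤ m)
    {a b : ℕ} (hab : a ≤ b) (hb : b ≤ N) :
    cs b v = cs a v + ((b : ℤ) - a) - (m + 1) * #{i ∈ Ico a b | vs i = v} := by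
  induction b, hab using Nat.le_induction with
  | base => simp
  | succ b hab ih =>
    rw [hcs b (by omega), ← Finset.insert_Ico_right_eq_Ico_add_one hab, filter_insert]
    by_cases h : v = vs b
    · subst h
      rw [if_pos rfl, card_insert_of_notMem (by simp)]
      simp only [fireK, if_true, ih (by omega)]
      push_cast
      ring
    · rw [if_neg (Ne.symm h)]
      simp only [fireK, if_neg h, Nat.add_sub_cancel, if_pos hv, ih (by omega)]
      push_cast
      ring

theorem firing_sequence_apply_of_lt {m N : ℕ} {cs : ℕ → ℕ → ℤ} {vs : ℕ → ℕ}
    (hvs : ∀ j < N, vs j ≤ m)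
    (hcs : ∀ j < N, cs (j + 1) = fireK (m + 1) (vs j) (cs j)) {v : ℕ} (hv : m < v)
    {b : ℕ} (hb : b ≤ N) : cs b v = cs 0 v := by
  induction b with
  | zero => rfl
  | succ b ih =>
    have := hvs b (by omega)
    rw [hcs b (by omega), ← ih (by omega)]
    simp only [fireK, if_neg (show v ≠ vs b by omega), Nat.add_sub_cancel,
      if_neg (show ¬ v ≤ m by omega)]

/-- Every nonempty set of vertices has a member that retains as many dollars as the other
members of the set each firing once would give it. -/
def IsRecurrentTuple {m : ℕ} (h : Fin m → Fin m) : Prop :=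
  ∀ A : Finset (Fin m), A.Nonempty → ∃ v ∈ A, #A ≤ (h v : ℕ) + 1

theorem IsRecurrentTuple.le_sort {m : ℕ} {h : Fin m → Fin m} (hh : IsRecurrentTuple h)
    (j : Fin m) : (j : ℕ) ≤ h (Tuple.sort h j) := by
  obtain ⟨v, hv, hle⟩ := hh ((Iic j).map (Tuple.sort h).toEmbedding) (by simp)
  rw [card_map, Fin.card_Iic] at hle
  obtain ⟨i, hi, rfl⟩ := mem_map.1 hv
  have := Fin.le_def.1 (Tuple.monotone_sort h (mem_Iic.1 hi))
  simp only [Function.comp_apply, Equiv.coe_toEmbedding] at this hle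
  omega

theorem isRecurrentTuple_of_criticalK {m : ℕ} {d : ℕ → ℤ} {h : Fin m → Fin m}
    (hd : ∀ j : Fin m, d (j + 1) = (h j : ℕ)) (hc : CriticalK (m + 1) d) :
    IsRecurrentTuple h := by
  obtain ⟨-, N, cs, vs, hN, h0, hN', hvs, hcs, hleg, -⟩ := hc
  simp only [Nat.add_sub_cancel, Nat.cast_add, Nat.cast_one, add_sub_cancel_right] at hvs hleg
  intro A hA
  have hnonneg : ∀ b ≤ N, ∀ v : Fin m, 0 ≤ cs b (v + 1) := by
    intro b
    induction b with
    | zero => intro _ v; rw [h0, hd]; positivity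
    | succ b ih =>
      intro hb v
      have h1 := ih (by omega) v
      have h2 := hleg b (by omega)
      rw [hcs b (by omega)]
      by_cases hv : (v : ℕ) + 1 = vs b
      · have := h2 (by omega)
        simp only [fireK, if_pos hv]
        push_cast
        omega
      · simp only [fireK, if_neg hv, Nat.add_sub_cancel, if_pos (show (v : ℕ) + 1 ≤ m by omega)]
        omega
  have hfired : ∀ v : Fin m, ({i ∈ range N | vs i = v + 1} : Finset ℕ).Nonempty := by
    intro v
    have := firing_sequence_apply hcs (show (v : ℕ) + 1 ≤ m by omega) (Nat.zero_le N) le_rfl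
    rw [h0, hN', Nat.Ico_zero_eq_range] at this
    by_contra hne
    rw [not_nonempty_iff_eq_empty] at hne
    rw [hne] at this
    simp at this
    omega
  -- The member of `A` whose last firing comes first.
  let last : Fin m → ℕ := fun v => ({i ∈ range N | vs i = v + 1} : Finset ℕ).max' (hfired v)
  have hlast : ∀ v, last v < N ∧ vs (last v) = v + 1 := fun v => by
    simpa only [mem_filter, mem_range] using max'_mem _ (hfired v)
  have hmax : ∀ v : Fin m, ∀ i < N, vs i = v + 1 → i ≤ last v := fun v i hi hvi =>
    le_max' _ _ (by simp [hi, hvi])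
  obtain ⟨u, hu, hmin⟩ := exists_min_image A last hA
  refine ⟨u, hu, ?_⟩
  have hlt := (hlast u).1
  have happ := firing_sequence_apply hcs (show (u : ℕ) + 1 ≤ m by omega)
    (show last u + 1 ≤ N from hlt) le_rfl
  have hempty : ({i ∈ Ico (last u + 1) N | vs i = u + 1} : Finset ℕ) = ∅ := by
    rw [filter_eq_empty_iff]
    intro i hi hvi
    rw [mem_Ico] at hi
    have := hmax u i hi.2 hvi
    omega
  rw [hempty, hN', hd] at happ
  have h1 := hnonneg (last u + 1) hlt u
  have hinj : Function.Injective last := by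
    intro v w hvw
    have hv := (hlast v).2
    rw [hvw, (hlast w).2] at hv
    exact Fin.ext (by omega)
  have hcard : #A ≤ #(Ico (last u) N) := by
    refine card_le_card_of_injOn last (fun v hv => ?_) hinj.injOn
    simpa using ⟨hmin v hv, (hlast v).1⟩
  rw [Nat.card_Ico] at hcard
  simp only [card_empty, Nat.cast_zero, mul_zero, sub_zero] at happ
  push_cast at happ
  omega

theorem criticalK_of_isRecurrentTuple {m : ℕ} {d : ℕ → ℤ} {h : Fin m → Fin m}
    (hd : ∀ j : Fin m, d (j + 1) = (h j : ℕ)) (hh : IsRecurrentTuple h) :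
    CriticalK (m + 1) d := by
  have hstable : StableK (m + 1) d := by
    intro v hv hvm
    obtain ⟨w, rfl⟩ : ∃ w : Fin m, v = w + 1 := ⟨⟨v - 1, by omega⟩, by simp; omega⟩
    rw [hd]
    have := (h w).2
    push_cast
    omega
  -- The bank fires first, then the other vertices in decreasing order of their values.
  let vs : ℕ → ℕ := fun t => if ht : 1 ≤ t ∧ t ≤ m then Tuple.sort h ⟨m - t, by omega⟩ + 1 else 0
  let cs : ℕ → ℕ → ℤ := fun j => Nat.rec d (fun i c => fireK (m + 1) (vs i) c) j
  have hvs : ∀ t, vs t ≤ m := fun t => by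
    by_cases ht : 1 ≤ t ∧ t ≤ m
    · simp only [vs, dif_pos ht]; omega
    · simp only [vs, dif_neg ht]; omega
  have hinj : ∀ t ≤ m, ∀ t' ≤ m, vs t = vs t' → t = t' := by
    intro t ht t' ht' heq
    by_cases h1 : 1 ≤ t <;> by_cases h2 : 1 ≤ t'
    · simp only [vs, dif_pos (And.intro h1 ht), dif_pos (And.intro h2 ht')] at heq
      have := congrArg Fin.val ((Tuple.sort h).injective (Fin.ext (Nat.add_right_cancel heq)))
      simp only at this
      omega
    · simp [vs, h1, h2, ht] at heq
    · simp [vs, h1, h2, ht'] at heq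
    · omega
  have hcs : ∀ j < m + 1, cs (j + 1) = fireK (m + 1) (vs j) (cs j) := fun j _ => rfl
  have hsurj : ∀ v ≤ m, ∃ t ≤ m, vs t = v := by
    intro v hv
    obtain ⟨t, ht, hvt⟩ := surj_on_of_inj_on_of_card_le (s := range (m + 1)) (t := range (m + 1))
      (fun t _ => vs t) (fun t _ => mem_range.2 (Nat.lt_succ_of_le (hvs t)))
      (fun t t' ht ht' => hinj t (by simpa [Nat.lt_succ_iff] using ht) t'
        (by simpa [Nat.lt_succ_iff] using ht')) le_rfl v (mem_range.2 (by omega))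
    exact ⟨t, by simpa [Nat.lt_succ_iff] using ht, hvt.symm⟩
  refine ⟨hstable, m + 1, cs, vs, by omega, rfl, ?_, fun j _ => hvs j, hcs, ?_, ?_⟩
  · ext v
    by_cases hv : v ≤ m
    · rw [firing_sequence_apply hcs hv (Nat.zero_le _) le_rfl]
      obtain ⟨t, ht, hvt⟩ := hsurj v hv
      have : ({i ∈ Ico 0 (m + 1) | vs i = v} : Finset ℕ) = {t} := by
        ext i
        simp only [mem_filter, mem_Ico, mem_singleton]
        constructor
        · rintro ⟨hi, hiv⟩
          exact hinj i (by omega) t ht (hiv.trans hvt.symm)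
        · rintro rfl
          exact ⟨by omega, hvt⟩
      rw [this]
      simp [cs]
    · exact firing_sequence_apply_of_lt (fun j _ => hvs j) hcs (by omega) le_rfl
  · intro t ht hne
    have ht1 : 1 ≤ t ∧ t ≤ m := by
      by_contra hcon
      exact hne (dif_neg hcon)
    rw [firing_sequence_apply hcs (hvs t) (Nat.zero_le t) ht.le]
    have hempty : ({i ∈ Ico 0 t | vs i = vs t} : Finset ℕ) = ∅ := by
      rw [filter_eq_empty_iff]
      intro i hi hvi
      rw [mem_Ico] at hi
      have := hinj i (by omega) t (by omega) hvi
      omega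
    rw [hempty]
    have hval : cs 0 (vs t) = (h (Tuple.sort h ⟨m - t, by omega⟩) : ℕ) := by
      rw [← hd]
      simp only [vs, dif_pos ht1]
      rfl
    have := hh.le_sort ⟨m - t, by omega⟩
    simp only at this
    rw [hval]
    simp
    omega
  · intro t ht h0
    have : t = 0 := hinj t (by omega) 0 (by omega) (h0.trans (by simp [vs]))
    subst this
    exact hstable

theorem criticalK_iff {m : ℕ} {d : ℕ → ℤ} {h : Fin m → Fin m}
    (hd : ∀ j : Fin m, d (j + 1) = (h j : ℕ)) :
    CriticalK (m + 1) d ↔ IsRecurrentTuple h :=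
  ⟨isRecurrentTuple_of_criticalK hd, criticalK_of_isRecurrentTuple hd⟩

/-- Parking functions of length `m` with values in `{0, …, m - 1}`, in Hall form. -/
def IsParking {m : ℕ} (g : Fin m → ℕ) : Prop :=
  ∀ A : Finset (Fin m), A.Nonempty → ∃ v ∈ A, g v + #A < m + 1

theorem exists_isParking_translate {m : ℕ} (x : Fin m → ZMod (m + 1)) :
    ∃ (g : Fin m → ℕ) (t : ZMod (m + 1)), IsParking g ∧ ∀ v, (g v : ZMod (m + 1)) + t = x v := by
  let T : Set (Fin m → ℕ) := {g | ∃ t : ZMod (m + 1), ∀ v, (g v : ZMod (m + 1)) + t = x v}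
  have hT : T.Nonempty := ⟨fun v => (x v).val, 0, fun v => by simp⟩
  let g := Function.argminOn (fun g : Fin m → ℕ => ∑ v, g v) T hT
  obtain ⟨t, ht⟩ : g ∈ T := Function.argminOn_mem _ T hT
  refine ⟨g, t, fun A hA => ?_, ht⟩
  by_contra! hcon
  have hAm : #A ≤ m := by simpa using card_le_univ A
  let g' : Fin m → ℕ := fun v => if v ∈ A then g v - (m + 1 - #A) else g v + #A
  have hg' : ∀ v, g' v + (if v ∈ A then m + 1 else 0) = g v + #A := by
    intro v
    by_cases hv : v ∈ A
    · have := hcon v hv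
      simp only [g', if_pos hv]
      omega
    · simp [g', hv]
  have hmem : g' ∈ T := by
    refine ⟨t - #A, fun v => ?_⟩
    have h1 := congrArg (Nat.cast : ℕ → ZMod (m + 1)) (hg' v)
    have h2 : ((if v ∈ A then m + 1 else 0 : ℕ) : ZMod (m + 1)) = 0 := by
      split_ifs
      · exact ZMod.natCast_self _
      · simp
    rw [Nat.cast_add, h2, add_zero, Nat.cast_add] at h1
    rw [h1, ← ht v]
    ring
  have hle : ∑ v, g v ≤ ∑ v, g' v :=
    Function.argminOn_le (fun g : Fin m → ℕ => ∑ v, g v) T hmem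
  have hsum := Finset.sum_congr rfl fun v (_ : v ∈ univ) => hg' v
  rw [sum_add_distrib, sum_add_distrib, sum_ite_mem, univ_inter, sum_const, sum_const,
    card_univ, Fintype.card_fin, smul_eq_mul, smul_eq_mul] at hsum
  have := hA.card_pos
  nlinarith

theorem IsParking.lt {m : ℕ} {g : Fin m → ℕ} (hg : IsParking g) (v : Fin m) : g v < m := by
  obtain ⟨w, hw, hlt⟩ := hg {v} (singleton_nonempty v)
  rw [mem_singleton.1 hw, card_singleton] at hlt
  omega

theorem IsParking.translate_eq_zero {m : ℕ} {g g' : Fin m → ℕ} (hg : IsParking g)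
    (hg' : IsParking g') {t : ZMod (m + 1)} (h : ∀ v, (g' v : ZMod (m + 1)) = g v + t) :
    t = 0 := by
  by_contra hne
  have ht0 : 0 < t.val := Nat.pos_of_ne_zero (by rwa [Ne, ZMod.val_eq_zero])
  have htm := t.val_lt
  have hmod : ∀ v, g' v = (g v + t.val) % (m + 1) := by
    intro v
    have h1 : ((g' v : ℕ) : ZMod (m + 1)) = ((g v + t.val : ℕ) : ZMod (m + 1)) := by
      rw [h v]; simp
    rw [ZMod.natCast_eq_natCast_iff'] at h1
    rwa [Nat.mod_eq_of_lt (by have := hg'.lt v; omega)] at h1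
  have hA : #{v | m + 1 ≤ g v + t.val} < t.val := by
    rcases eq_empty_or_nonempty ({v | m + 1 ≤ g v + t.val} : Finset (Fin m)) with he | he
    · rwa [he, card_empty]
    · obtain ⟨v, hv, hlt⟩ := hg _ he
      have := (mem_filter.1 hv).2
      omega
  have hB : #{v | ¬ m + 1 ≤ g v + t.val} < m + 1 - t.val := by
    rcases eq_empty_or_nonempty ({v | ¬ m + 1 ≤ g v + t.val} : Finset (Fin m)) with he | he
    · rw [he, card_empty]; omega
    · obtain ⟨v, hv, hlt⟩ := hg' _ he
      have := (mem_filter.1 hv).2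
      rw [hmod v, Nat.mod_eq_of_lt (by omega)] at hlt
      omega
  have := card_filter_add_card_filter_not (s := (univ : Finset (Fin m)))
    (fun v => m + 1 ≤ g v + t.val)
  rw [card_univ, Fintype.card_fin] at this
  omega

theorem isParking_rev_iff {m : ℕ} {h : Fin m → Fin m} :
    IsParking (fun v => ((h v).rev : ℕ)) ↔ IsRecurrentTuple h := by
  refine forall₂_congr fun A _ => exists_congr fun v => and_congr_right fun _ => ?_
  have := (h v).2
  simp only [Fin.val_rev]
  omega

theorem card_isRecurrentTuple {m : ℕ} (hm : 1 ≤ m) :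
    Nat.card {h : Fin m → Fin m // IsRecurrentTuple h} = (m + 1) ^ (m - 1) := by
  let F : {h : Fin m → Fin m // IsRecurrentTuple h} × ZMod (m + 1) → Fin m → ZMod (m + 1) :=
    fun p v => (((p.1.1 v).rev : ℕ) : ZMod (m + 1)) + p.2
  have hF : Function.Bijective F := by
    constructor
    · rintro ⟨⟨h, hh⟩, t⟩ ⟨⟨h', hh'⟩, t'⟩ heq
      have heq' : ∀ v, (((h v).rev : ℕ) : ZMod (m + 1)) + t =
          (((h' v).rev : ℕ) : ZMod (m + 1)) + t' :=
        fun v => congrFun heq v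
      have htt : t' - t = 0 := (isParking_rev_iff.2 hh').translate_eq_zero (isParking_rev_iff.2 hh)
        fun v => by linear_combination heq' v
      obtain rfl : t' = t := sub_eq_zero.1 htt
      have : h = h' := by
        ext v
        have hv := add_right_cancel (heq' v)
        rw [ZMod.natCast_eq_natCast_iff', Nat.mod_eq_of_lt (by omega),
          Nat.mod_eq_of_lt (by omega)] at hv
        exact congrArg Fin.val (Fin.rev_injective (Fin.ext hv))
      subst this
      rfl
    · intro x
      obtain ⟨g, t, hg, ht⟩ := exists_isParking_translate x
      refine ⟨⟨⟨fun v => Fin.rev ⟨g v, hg.lt v⟩, isParking_rev_iff.1 (by simpa using hg)⟩, t⟩, ?_⟩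
      ext1 v
      simpa only [F, Fin.rev_rev] using ht v
  have hcard := Nat.card_congr (Equiv.ofBijective F hF)
  rw [Nat.card_prod, Nat.card_zmod, Nat.card_fun, Nat.card_zmod, Nat.card_fin] at hcard
  obtain ⟨l, rfl⟩ : ∃ l, m = l + 1 := ⟨m - 1, by omega⟩
  rw [pow_succ] at hcard
  exact Nat.eq_of_mul_eq_mul_right (by omega) hcard

/-- Splitting the vertices of the hyperpath other than the bank into its edges. -/
def blockEquiv (m n : ℕ) : (Fin (n * m) → Fin m) ≃ (Fin n → Fin m → Fin m) :=
  (finProdFinEquiv.symm.arrowCongr (Equiv.refl _)).trans (Equiv.curry _ _ _)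

theorem criticalK_inducedConf_iff {m n : ℕ} (f : Fin (n * m) → Fin m) (i : Fin n) :
    CriticalK (m + 1) (inducedConf (m + 1) (i + 1) (tupleConf (m + 1) n f)) ↔
      IsRecurrentTuple (blockEquiv m n f i) := by
  refine criticalK_iff fun j => ?_
  have hlt := (finProdFinEquiv (i, j)).2
  have hval : (finProdFinEquiv (i, j) : ℕ) = i * m + j := by
    simp [finProdFinEquiv, mul_comm, add_comm]
  simp only [inducedConf, tupleConf, Nat.add_sub_cancel]
  rw [dif_pos (by omega)]
  have : (⟨i * m + (j + 1) - 1, by omega⟩ : Fin (n * m)) = finProdFinEquiv (i, j) :=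
    Fin.ext (by simp only [hval]; omega)
  rw [this]
  rfl

theorem memBtuple_iff {m n s : ℕ} (hs : s ≤ n) (f : Fin (n * m) → Fin m) :
    MemBtuple (m + 1) n s f ↔ ∀ i : Fin n,
      ((i : ℕ) < s → IsRecurrentTuple (blockEquiv m n f i)) ∧
      ((i : ℕ) = s → ¬ IsRecurrentTuple (blockEquiv m n f i)) := by
  simp only [← criticalK_inducedConf_iff]
  constructor
  · rintro ⟨h1, h2⟩ i
    refine ⟨fun hi => h1 _ (by omega) (by omega), ?_⟩
    rintro rfl
    exact h2 i.2
  · intro h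
    refine ⟨fun i hi1 his => ?_, fun hsn => (h ⟨s, hsn⟩).2 rfl⟩
    have := (h ⟨i - 1, by omega⟩).1 (by simp only; omega)
    simpa only [Nat.sub_add_cancel hi1] using this

open Classical in
theorem card_memBtuple {m n s : ℕ} (hm : 1 ≤ m) (hs : s ≤ n) :
    Nat.card {f : Fin (n * m) → Fin m // MemBtuple (m + 1) n s f} =
      ∏ i ∈ range n, if i < s then (m + 1) ^ (m - 1)
        else if i = s then m ^ m - (m + 1) ^ (m - 1) else m ^ m := by
  let S : Fin n → Finset (Fin m → Fin m) := fun i =>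
    {h | ((i : ℕ) < s → IsRecurrentTuple h) ∧ ((i : ℕ) = s → ¬ IsRecurrentTuple h)}
  have hS : ∀ i : Fin n, #(S i) = if (i : ℕ) < s then (m + 1) ^ (m - 1)
      else if (i : ℕ) = s then m ^ m - (m + 1) ^ (m - 1) else m ^ m := by
    intro i
    have hcard : #{h : Fin m → Fin m | IsRecurrentTuple h} = (m + 1) ^ (m - 1) := by
      rw [← card_isRecurrentTuple hm, Nat.card_eq_fintype_card, Fintype.card_subtype]
    split_ifs with h1 h2
    · simp [S, h1, h1.ne, hcard]
    · have := card_filter_add_card_filter_not (s := (univ : Finset (Fin m → Fin m)))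
        IsRecurrentTuple
      rw [hcard, card_univ, Fintype.card_fun, Fintype.card_fin] at this
      simp only [S, h2, lt_irrefl, false_imp_iff, true_imp_iff, true_and]
      omega
    · simp [S, h1, h2]
  have e : {f : Fin (n * m) → Fin m // MemBtuple (m + 1) n s f} ≃ Fintype.piFinset S :=
    (blockEquiv m n).subtypeEquiv fun f => by simp [memBtuple_iff hs, S]
  rw [Nat.card_congr e, Nat.card_eq_fintype_card, Fintype.card_coe, Fintype.card_piFinset]
  simp only [hS]
  exact Fin.prod_univ_eq_prod_range (fun i => if i < s then (m + 1) ^ (m - 1)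
    else if i = s then m ^ m - (m + 1) ^ (m - 1) else m ^ m) n

/-- Counting the sets `B_s` for the hyperpath `P_n^k` (`k ≥ 3`, `n ≥ 1`),
identifying stable configurations with tuples of values at the vertices
`1, …, n(k-1)`: for `0 ≤ s ≤ n-1`,
`|B_s| = k^{s(k-2)}·((k-1)^{k-1} - k^{k-2})·(k-1)^{(n-s-1)(k-1)}`, and
`|B_n| = k^{n(k-2)}`. -/
theorem card_Bs (k n : ℕ) (hk : 3 ≤ k) (hn : 1 ≤ n) :
    (∀ s < n, Nat.card {f : Fin (n * (k - 1)) → Fin (k - 1) // MemBtuple k n s f} =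
      k ^ (s * (k - 2)) * ((k - 1) ^ (k - 1) - k ^ (k - 2)) *
        (k - 1) ^ ((n - s - 1) * (k - 1))) ∧
    Nat.card {f : Fin (n * (k - 1)) → Fin (k - 1) // MemBtuple k n n f} =
      k ^ (n * (k - 2)) := by
  obtain ⟨m, rfl⟩ : ∃ m, k = m + 1 := ⟨k - 1, by omega⟩
  have hm : 1 ≤ m := by omega
  simp only [Nat.add_sub_cancel, show m + 1 - 2 = m - 1 by omega]
  constructor
  · intro s hs
    refine (card_memBtuple hm hs.le).trans ?_
    obtain ⟨r, rfl⟩ : ∃ r, n = s + 1 + r := ⟨n - (s + 1), by omega⟩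
    rw [prod_range_add, prod_range_succ, prod_congr rfl fun i hi => if_pos (mem_range.1 hi),
      prod_const, card_range, if_neg (lt_irrefl s), if_pos rfl,
      prod_congr rfl fun i _ => (if_neg (show ¬ s + 1 + i < s by omega)).trans
        (if_neg (show s + 1 + i ≠ s by omega)), prod_const, card_range, ← pow_mul, ← pow_mul,
      show s + 1 + r - s - 1 = r by omega, mul_comm s, mul_comm r]
  · refine (card_memBtuple hm le_rfl).trans ?_
    rw [prod_congr rfl fun i hi => if_pos (mem_range.1 hi),
      prod_const, card_range, ← pow_mul, mul_comm n]
end
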